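/- Let A be a finite-dimensional C-algebra with an action of a finite group G by C-algebra automorphisms, and suppose the only G-invariant ideals of A are 0 and A, with E_A ≠ 0. Then Rad(A) = 0, i.e., A is a semisimple C-algebra. -/

import Mathlib

/-- Data of a linear operad: spaces of `n`-ary operations, an identity operation,
and partial compositions. -/
structure LinearOperadData (F : Type) [Field F] where
  C : ℕ → Type
  one : C 1
  comp : ∀ {m n : ℕ}, C m → C n → Fin m → C (m + n - 1)

/-- An algebra over (the data of) a linear operad: structure maps
`α n : C n → MultilinearMap`, compatible with identity and composition. -/
structure OperadAlgebraOn (F : Type) [Field F] (O : LinearOperadData F)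
    (A : Type) [AddCommGroup A] [Module F A] where
  α : ∀ n, O.C n → MultilinearMap F (fun _ : Fin n => A) A
  α_one : ∀ a : A, α 1 O.one (fun _ => a) = a
  α_comp : ∀ {m n : ℕ} (c : O.C m) (d : O.C n) (i : Fin m) (v : Fin (m + n - 1) → A),
    α (m + n - 1) (O.comp c d i) v =
      α m c (fun k =>
        if hk : (k : ℕ) < (i : ℕ) then v ⟨k, by have := k.isLt; have := i.isLt; omega⟩
        else if hk2 : (k : ℕ) = (i : ℕ) then
          α n d (fun j => v ⟨(i : ℕ) + (j : ℕ), by have := j.isLt; have := i.isLt; omega⟩)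
        else v ⟨(k : ℕ) + n - 1, by have := k.isLt; have := i.isLt; omega⟩)

variable {F : Type} [Field F] {O : LinearOperadData F}
variable {A : Type} [AddCommGroup A] [Module F A]

/-- The partial multiplication operator `a ↦ α n c (v_1,...,a at slot j,...,v_{n-1})`. -/
def OperadAlgebraOn.op (OA : OperadAlgebraOn F O A) {n : ℕ} (c : O.C n)
    (v : Fin n → A) (j : Fin n) : Module.End F A :=
  (OA.α n c).toLinearMap v j

/-- `E_A`: the span of the partial multiplication operators with `n ≥ 2` inputs. -/
def EA (OA : OperadAlgebraOn F O A) : Submodule F (Module.End F A) :=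
  Submodule.span F
    {T | ∃ n : ℕ, 2 ≤ n ∧ ∃ (c : O.C n) (v : Fin n → A) (j : Fin n), T = OA.op c v j}

/-- `L_A`: the image of `C(1)` in `End_F(A)`. -/
def LA (OA : OperadAlgebraOn F O A) : Submodule F (Module.End F A) :=
  Submodule.span F {T | ∃ c : O.C 1, T = OA.op c (fun _ => (0 : A)) 0}

/-- `R_A = L_A + E_A`. -/
def RA (OA : OperadAlgebraOn F O A) : Submodule F (Module.End F A) :=
  LA OA ⊔ EA OA

/-- A subspace `I ⊆ A` is an ideal: closed under all operadic operations whenever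
at least one argument lies in `I`. -/
def IsIdealPred (OA : OperadAlgebraOn F O A) (I : Submodule F A) : Prop :=
  ∀ (n : ℕ) (c : O.C n) (v : Fin n → A) (j : Fin n), v j ∈ I → OA.α n c v ∈ I

/-- A relative ideal `J` of the subalgebra `P ⊆ A`. -/
def IsIdealIn (OA : OperadAlgebraOn F O A) (P J : Submodule F A) : Prop :=
  J ≤ P ∧ ∀ (n : ℕ) (c : O.C n) (v : Fin n → A) (j : Fin n),
    (∀ k, v k ∈ P) → v j ∈ J → OA.α n c v ∈ J

/-- The multiplications (with `n ≥ 2`) of `A` do not all vanish on the subspace `P`. -/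
def HasNonzeroMul (OA : OperadAlgebraOn F O A) (P : Submodule F A) : Prop :=
  ∃ n : ℕ, 2 ≤ n ∧ ∃ (c : O.C n) (v : Fin n → A), (∀ k, v k ∈ P) ∧ OA.α n c v ≠ 0

/-- `P` is a simple summand: an ideal of `A`, with no nontrivial subideals,
on which the multiplication is nonzero. -/
def IsSimplePiece (OA : OperadAlgebraOn F O A) (P : Submodule F A) : Prop :=
  IsIdealPred OA P ∧ (∀ J ≤ P, IsIdealPred OA J → J = ⊥ ∨ J = P) ∧ HasNonzeroMul OA P

/-- `A` is a simple `C`-algebra: the only ideals are `0` and `A`, and `E_A ≠ 0`. -/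
def IsSimpleAlg (OA : OperadAlgebraOn F O A) : Prop :=
  (∀ I : Submodule F A, IsIdealPred OA I → I = ⊥ ∨ I = ⊤) ∧ EA OA ≠ ⊥

/-- `A` is a semisimple `C`-algebra: a finite direct sum of simple `C`-algebras. -/
def IsSemisimpleAlg (OA : OperadAlgebraOn F O A) : Prop :=
  ∃ (m : ℕ) (P : Fin m → Submodule F A),
    iSupIndep P ∧ (⨆ i, P i) = ⊤ ∧ ∀ i, IsSimplePiece OA (P i)

/-- The group of `C`-algebra automorphisms of `A`, as a subgroup of `A ≃ₗ[F] A`. -/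
def AlgAutGroup (OA : OperadAlgebraOn F O A) : Subgroup (A ≃ₗ[F] A) where
  carrier := {f | ∀ (n : ℕ) (c : O.C n) (v : Fin n → A),
    f (OA.α n c v) = OA.α n c (fun k => f (v k))}
  one_mem' := by intro n c v; rfl
  mul_mem' := by
    intro f g hf hg n c v
    show f (g (OA.α n c v)) = _
    rw [hg, hf]
    rfl
  inv_mem' := by
    intro f hf n c v
    have h1 : ∀ x : A, f (f⁻¹ x) = x := fun x => f.apply_symm_apply x
    apply f.injective
    rw [h1, hf]
    simp only [h1]

/-- A maximal (proper) ideal of `A`. -/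
def IsMaxIdeal (OA : OperadAlgebraOn F O A) (M : Submodule F A) : Prop :=
  IsIdealPred OA M ∧ M ≠ ⊤ ∧ ∀ J, IsIdealPred OA J → M < J → J = ⊤

/-- The kernel of the projection to the maximal semisimple quotient of `A`
as an `R_A`-module (the intersection of the maximal ideals). -/
def preRad (OA : OperadAlgebraOn F O A) : Submodule F A :=
  sInf {M | IsMaxIdeal OA M}

/-- The radical of the `C`-algebra `A`: the kernel of `A → Ā`, where `Ā` is the quotient of
the maximal semisimple `R_A`-module quotient `A' = A / preRad` by the kernel of the
`E_A`-action. -/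
def radAlg (OA : OperadAlgebraOn F O A) : Submodule F A :=
  ⨅ (e : Module.End F A) (_ : e ∈ EA OA), (preRad OA).comap e

/-- An operad algebra structure on `A ⧸ I` compatible with the projection. -/
def IsQuotientAlg (OA : OperadAlgebraOn F O A) (I : Submodule F A)
    (OQ : OperadAlgebraOn F O (A ⧸ I)) : Prop :=
  ∀ (n : ℕ) (c : O.C n) (v : Fin n → A),
    I.mkQ (OA.α n c v) = OQ.α n c (fun k => I.mkQ (v k))

/-- A componentwise ("pointwise") operad algebra structure on a product. -/
def IsComponentwiseAlg {ι : Type} {B : ι → Type} [∀ i, AddCommGroup (B i)]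
    [∀ i, Module F (B i)] (OB : ∀ i, OperadAlgebraOn F O (B i))
    (OP : OperadAlgebraOn F O (∀ i, B i)) : Prop :=
  ∀ (n : ℕ) (c : O.C n) (v : Fin n → ∀ i, B i) (i : ι),
    OP.α n c v i = (OB i).α n c (fun k => v k i)

/-- Pointwise algebra structure on `ι → B`. -/
def IsPointwiseAlg {ι B : Type} [AddCommGroup B] [Module F B]
    (OB : OperadAlgebraOn F O B) (OP : OperadAlgebraOn F O (ι → B)) : Prop :=
  ∀ (n : ℕ) (c : O.C n) (v : Fin n → ι → B) (i : ι),
    OP.α n c v i = OB.α n c (fun k => v k i)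

/-- Block-diagonal inclusion `End(B i) → End(Π j, B j)`. -/
def blkMap {ι : Type} [DecidableEq ι] (B : ι → Type) [∀ i, AddCommGroup (B i)]
    [∀ i, Module F (B i)] (i : ι) :
    Module.End F (B i) →ₗ[F] Module.End F (∀ j, B j) where
  toFun T := (LinearMap.single F B i) ∘ₗ T ∘ₗ (LinearMap.proj i)
  map_add' := by
    intro T S
    ext v j
    simp [Pi.single_add]
  map_smul' := by
    intro t T
    ext v j
    simp [Pi.single_smul]

/-- The action of `Perm ι` on `ι → K` by permuting coordinates. -/
def permAct (ι K : Type) [Group K] : Equiv.Perm ι →* MulAut (ι → K) where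
  toFun σ :=
    { toFun := fun f => f ∘ σ.symm
      invFun := fun f => f ∘ σ
      left_inv := fun f => by funext x; simp
      right_inv := fun f => by funext x; simp
      map_mul' := fun f g => rfl }
  map_one' := by
    ext f x
    rfl
  map_mul' := by
    intro σ τ
    ext f x
    rfl

/-- Right translation action of `G` on `G → B`. -/
def rightTrans (G B : Type) [Group G] (g : G) : (G → B) → (G → B) :=
  fun f x => f (x * g)

/-- The space `Fun_H(G, B)` of `H`-equivariant functions `G → B`. -/
def FunHsub (G : Type) [Group G] (B : Type) [AddCommGroup B] [Module F B]
    (H : Subgroup G) (OB : OperadAlgebraOn F O B) (φ : H →* AlgAutGroup OB) :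
    Submodule F (G → B) where
  carrier := {f | ∀ (h : H) (x : G),
    f ((h : G) * x) = ((φ h : AlgAutGroup OB) : B ≃ₗ[F] B) (f x)}
  add_mem' := by
    intro f g hf hg h x
    simp [hf h x, hg h x]
  zero_mem' := by intro h x; simp
  smul_mem' := by
    intro t f hf h x
    simp [hf h x]

/-- A bundled `C`-algebra (used for existential quantification over algebras). -/
structure OperadAlgBundle (F : Type) [Field F] (O : LinearOperadData F) where
  carrier : Type
  [acg : AddCommGroup carrier]
  [mod : Module F carrier]
  alg : OperadAlgebraOn F O carrier

attribute [instance] OperadAlgBundle.acg OperadAlgBundle.mod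

/-- `(A, ρ)` is modeled by `Fun_H(G, B)` for the pair `(H, φ)`:
there is an injective `G`-equivariant `C`-algebra map of `A` onto the subalgebra
`Fun_H(G, B)` of the pointwise algebra `G → B`, where `B` is simple and `G` acts by
right translation. -/
def IsFunHModel {G : Type} [Group G] (OA : OperadAlgebraOn F O A)
    (ρ : G →* (A ≃ₗ[F] A)) (H : Subgroup G) (Bb : OperadAlgBundle F O)
    (φ : H →* AlgAutGroup Bb.alg) : Prop :=
  IsSimpleAlg Bb.alg ∧
  ∃ OGB : OperadAlgebraOn F O (G → Bb.carrier),
    IsPointwiseAlg Bb.alg OGB ∧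
    ∃ e : A →ₗ[F] (G → Bb.carrier), Function.Injective e ∧
      LinearMap.range e = FunHsub G Bb.carrier H Bb.alg φ ∧
      (∀ (n : ℕ) (c : O.C n) (v : Fin n → A),
        e (OA.α n c v) = OGB.α n c fun k => e (v k)) ∧
      (∀ (g : G) (a : A) (x : G), e (ρ g a) x = e a (x * g))

theorem OperadAlgebraOn.op_apply (OA : OperadAlgebraOn F O A) {n : ℕ} (c : O.C n)
    (v : Fin n → A) (j : Fin n) (a : A) : OA.op c v j a = OA.α n c (Function.update v j a) :=
  rfl

theorem OperadAlgebraOn.op_apply_self (OA : OperadAlgebraOn F O A) {n : ℕ} (c : O.C n)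
    (v : Fin n → A) (j : Fin n) : OA.op c v j (v j) = OA.α n c v := by
  rw [OA.op_apply, Function.update_eq_self]

/-- Precomposing a partial multiplication operator with a unary operation gives a partial
multiplication operator of the same arity. -/
theorem OperadAlgebraOn.op_apply_unary (OA : OperadAlgebraOn F O A) {m : ℕ} (c : O.C m)
    (w : Fin m → A) (i : Fin m) (d : O.C 1) (u : Fin 1 → A) :
    OA.op c w i (OA.α 1 d u) = OA.op (n := m) (O.comp c d i) w i (u 0) := by
  rw [OA.op_apply, OA.op_apply]
  refine Eq.trans ?_ (OA.α_comp c d i (Function.update (β := fun _ => A) w i (u 0))).symm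
  congr 1
  funext k
  rcases lt_trichotomy k i with h | rfl | h
  · have h' : (k : ℕ) < i := h
    rw [dif_pos h', Function.update_of_ne h.ne]
    exact (Function.update_of_ne (β := fun _ => A) h.ne _ _).symm
  · rw [dif_neg (lt_irrefl _), dif_pos rfl, Function.update_self]
    congr 1
    funext j
    obtain rfl : j = 0 := Subsingleton.elim _ _
    exact (Function.update_self (β := fun _ => A) k _ _).symm
  · have h' : (i : ℕ) < k := h
    rw [dif_neg h'.not_gt, dif_neg h'.ne', Function.update_of_ne h.ne']
    exact (Function.update_of_ne (β := fun _ => A) h.ne' _ _).symm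

theorem op_mem_EA (OA : OperadAlgebraOn F O A) {n : ℕ} (hn : 2 ≤ n) (c : O.C n)
    (v : Fin n → A) (j : Fin n) : OA.op c v j ∈ EA OA :=
  Submodule.subset_span ⟨n, hn, c, v, j, rfl⟩

theorem IsIdealPred.op_mem {OA : OperadAlgebraOn F O A} {I : Submodule F A}
    (hI : IsIdealPred OA I) {n : ℕ} (c : O.C n) (v : Fin n → A) (j : Fin n) {a : A}
    (ha : a ∈ I) : OA.op c v j a ∈ I :=
  hI n c _ j (by simpa using ha)

theorem isIdealPred_of_op_mem {OA : OperadAlgebraOn F O A} {I : Submodule F A}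
    (h : ∀ (n : ℕ) (c : O.C n) (v : Fin n → A) (j : Fin n), ∀ a ∈ I, OA.op c v j a ∈ I) :
    IsIdealPred OA I := fun n c v j hv => OA.op_apply_self c v j ▸ h n c v j _ hv

theorem isIdealPred_preRad (OA : OperadAlgebraOn F O A) : IsIdealPred OA (preRad OA) := by
  intro n c v j hv
  rw [preRad, Submodule.mem_sInf] at hv ⊢
  exact fun M hM => hM.1 n c v j (hv M hM)

theorem IsIdealPred.comap {OA : OperadAlgebraOn F O A} {I : Submodule F A}
    (hI : IsIdealPred OA I) {f : A ≃ₗ[F] A} (hf : f ∈ AlgAutGroup OA) :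
    IsIdealPred OA (I.comap (f : A →ₗ[F] A)) := by
  intro n c v j hv
  change f (OA.α n c v) ∈ I
  rw [hf n c v]
  exact hI n c _ j hv

theorem IsMaxIdeal.comap {OA : OperadAlgebraOn F O A} {M : Submodule F A}
    (hM : IsMaxIdeal OA M) {f : A ≃ₗ[F] A} (hf : f ∈ AlgAutGroup OA) :
    IsMaxIdeal OA (M.comap (f : A →ₗ[F] A)) := by
  refine ⟨hM.1.comap hf, fun h => hM.2.1 ?_, fun J hJ hlt => ?_⟩
  · rw [eq_top_iff] at h ⊢
    intro x _
    simpa using h (Submodule.mem_top (x := f.symm x))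
  · have hJ' := hM.2.2 _ (hJ.comap (inv_mem hf)) <| by
      refine SetLike.lt_iff_le_and_exists.2 ⟨fun x hx => hlt.le ?_, ?_⟩
      · change f (f.symm x) ∈ M
        simpa using hx
      · obtain ⟨y, hyJ, hyM⟩ := SetLike.exists_of_lt hlt
        refine ⟨f y, ?_, hyM⟩
        change f.symm (f y) ∈ J
        simpa using hyJ
    rw [eq_top_iff] at hJ' ⊢
    intro x _
    have hx : f.symm (f x) ∈ J := hJ' (Submodule.mem_top (x := f x))
    simpa using hx

theorem map_mem_preRad {OA : OperadAlgebraOn F O A} {f : A ≃ₗ[F] A} (hf : f ∈ AlgAutGroup OA)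
    {x : A} (hx : x ∈ preRad OA) : f x ∈ preRad OA := by
  rw [preRad, Submodule.mem_sInf] at hx ⊢
  exact fun M hM => hx _ (IsMaxIdeal.comap hM hf)

theorem mem_radAlg_iff {OA : OperadAlgebraOn F O A} {a : A} :
    a ∈ radAlg OA ↔ ∀ n, 2 ≤ n → ∀ (c : O.C n) (v : Fin n → A) (j : Fin n),
      OA.op c v j a ∈ preRad OA := by
  simp only [radAlg, Submodule.mem_iInf, Submodule.mem_comap]
  refine ⟨fun h n hn c v j => h _ (op_mem_EA OA hn c v j), fun h e he => ?_⟩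
  induction he using Submodule.span_induction with
  | mem e he =>
    obtain ⟨n, hn, c, v, j, rfl⟩ := he
    exact h n hn c v j
  | zero => exact zero_mem _
  | add e e' _ _ h₁ h₂ => exact add_mem h₁ h₂
  | smul t e _ h₁ => exact Submodule.smul_mem _ t h₁

theorem isIdealPred_radAlg (OA : OperadAlgebraOn F O A) : IsIdealPred OA (radAlg OA) := by
  intro n c v j hv
  rw [mem_radAlg_iff] at hv ⊢
  intro m hm d w i
  obtain _ | _ | n := n
  · exact j.elim0
  · obtain rfl : j = 0 := Subsingleton.elim (α := Fin 1) _ _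
    rw [OA.op_apply_unary]
    exact hv m hm _ w i
  · refine (isIdealPred_preRad OA).op_mem d w i ?_
    rw [← OA.op_apply_self c v j]
    exact hv _ (by omega) c v j

theorem map_mem_radAlg {OA : OperadAlgebraOn F O A} {f : A ≃ₗ[F] A} (hf : f ∈ AlgAutGroup OA)
    {x : A} (hx : x ∈ radAlg OA) : f x ∈ radAlg OA := by
  rw [mem_radAlg_iff] at hx ⊢
  intro n hn c v j
  have h := map_mem_preRad hf (hx n hn c (fun k => f.symm (v k)) j)
  rw [OA.op_apply, hf n c] at h
  rw [OA.op_apply]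
  convert h using 2
  funext k
  rcases eq_or_ne k j with rfl | hk
  · simp
  · simp [hk]

/-- The unital algebra generated by the partial multiplication operators (of all arities). -/
def multAlg (OA : OperadAlgebraOn F O A) : Subalgebra F (Module.End F A) :=
  Algebra.adjoin F
    {T | ∃ (n : ℕ) (c : O.C n) (v : Fin n → A) (j : Fin n), T = OA.op c v j}

theorem isIdealPred_restrictScalars {OA : OperadAlgebraOn F O A}
    (N : Submodule (multAlg OA) A) : IsIdealPred OA (N.restrictScalars F) :=
  isIdealPred_of_op_mem fun n c v j _ ha =>
    N.smul_mem (⟨OA.op c v j, Algebra.subset_adjoin ⟨n, c, v, j, rfl⟩⟩ : multAlg OA) ha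

/-- An ideal of `A` as a submodule over the multiplication algebra. -/
def IsIdealPred.toSubmodule {OA : OperadAlgebraOn F O A} {I : Submodule F A}
    (hI : IsIdealPred OA I) : Submodule (multAlg OA) A where
  __ := I
  smul_mem' := by
    rintro ⟨r, hr⟩ x hx
    change r x ∈ I
    replace hx : x ∈ I := hx
    induction hr using Algebra.adjoin_induction generalizing x with
    | mem r hr =>
      obtain ⟨n, c, v, j, rfl⟩ := hr
      exact hI.op_mem c v j hx
    | algebraMap t => exact I.smul_mem t hx
    | add r s _ _ h₁ h₂ => exact add_mem (h₁ hx) (h₂ hx)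
    | mul r s _ _ h₁ h₂ => exact h₁ (h₂ hx)

@[simp]
theorem IsIdealPred.restrictScalars_toSubmodule {OA : OperadAlgebraOn F O A} {I : Submodule F A}
    (hI : IsIdealPred OA I) : hI.toSubmodule.restrictScalars F = I :=
  rfl

theorem isMaxIdeal_restrictScalars {OA : OperadAlgebraOn F O A}
    {N : Submodule (multAlg OA) A} (hN : IsCoatom N) :
    IsMaxIdeal OA (N.restrictScalars F) := by
  refine ⟨isIdealPred_restrictScalars N, fun h => hN.1 ?_, fun J hJ hlt => ?_⟩
  · exact Submodule.restrictScalars_injective F _ _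
      (h.trans (Submodule.restrictScalars_top F (multAlg OA) A).symm)
  · have h : hJ.toSubmodule = ⊤ := hN.2 _ hlt
    rw [← hJ.restrictScalars_toSubmodule, h, Submodule.restrictScalars_top]

theorem IsMaxIdeal.isCoatom_toSubmodule {OA : OperadAlgebraOn F O A} {M : Submodule F A}
    (hM : IsMaxIdeal OA M) : IsCoatom hM.1.toSubmodule := by
  refine ⟨fun h => hM.2.1 ?_, fun N hN => ?_⟩
  · rw [← hM.1.restrictScalars_toSubmodule, h, Submodule.restrictScalars_top]
  · exact Submodule.restrictScalars_injective F _ _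
      ((hM.2.2 _ (isIdealPred_restrictScalars N) hN).trans
        (Submodule.restrictScalars_top F (multAlg OA) A).symm)

theorem restrictScalars_jacobson (OA : OperadAlgebraOn F O A) :
    (Module.jacobson (multAlg OA) A).restrictScalars F = preRad OA := by
  ext x
  simp only [Module.jacobson, preRad, Submodule.restrictScalars_mem, Submodule.mem_sInf]
  exact ⟨fun h M hM => h _ (IsMaxIdeal.isCoatom_toSubmodule hM),
    fun h N hN => h _ (isMaxIdeal_restrictScalars hN)⟩

instance [FiniteDimensional F A] (OA : OperadAlgebraOn F O A) :
    IsArtinian (multAlg OA) A :=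
  isArtinian_of_tower F inferInstance

instance [FiniteDimensional F A] (OA : OperadAlgebraOn F O A) :
    IsNoetherian (multAlg OA) A :=
  isNoetherian_of_tower F inferInstance

theorem preRad_ne_top [FiniteDimensional F A] [Nontrivial A] (OA : OperadAlgebraOn F O A) :
    preRad OA ≠ ⊤ := by
  obtain ⟨N, hN⟩ := IsCoatomic.exists_coatom (Submodule (multAlg OA) A)
  have hM := isMaxIdeal_restrictScalars hN
  exact fun h => hM.2.1 (top_le_iff.1 (h ▸ sInf_le hM))

theorem isSemisimpleModule_multAlg [FiniteDimensional F A] {OA : OperadAlgebraOn F O A}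
    (h : preRad OA = ⊥) : IsSemisimpleModule (multAlg OA) A := by
  rw [IsArtinian.isSemisimpleModule_iff_jacobson]
  apply Submodule.restrictScalars_injective F
  rw [restrictScalars_jacobson, h, Submodule.restrictScalars_bot]

/-- If `A = P ⊕ Q` as a sum of ideals, then a product with an argument in `P` only depends on
the components of the other arguments in `P`. -/
theorem IsIdealPred.α_congr {OA : OperadAlgebraOn F O A} {P Q : Submodule F A}
    (hP : IsIdealPred OA P) (hQ : IsIdealPred OA Q) (hPQ : Disjoint P Q) {n : ℕ} (c : O.C n)
    {v w : Fin n → A} (j : Fin n) (hvj : v j ∈ P) (hwj : w j = v j)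
    (hvw : ∀ k, w k - v k ∈ Q) : OA.α n c w = OA.α n c v := by
  classical
  suffices h : ∀ s : Finset (Fin n), OA.α n c (s.piecewise w v) = OA.α n c v by
    simpa using h Finset.univ
  intro s
  induction s using Finset.induction_on with
  | empty => simp
  | insert k s hk ih =>
    rw [← ih, Finset.piecewise_insert]
    have hself : s.piecewise w v = Function.update (s.piecewise w v) k (v k) := by
      rw [eq_comm, Function.update_eq_self_iff, Finset.piecewise_eq_of_notMem _ _ _ hk]
    rcases eq_or_ne k j with rfl | hkj
    · rw [hwj, ← hself]
    · nth_rewrite 2 [hself]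
      rw [← sub_eq_zero, ← MultilinearMap.map_update_sub]
      refine Submodule.disjoint_def.1 hPQ _ (hP n c _ j ?_) (hQ n c _ k ?_)
      · rw [Function.update_of_ne hkj.symm]
        by_cases hj : j ∈ s
        · rw [Finset.piecewise_eq_of_mem _ _ _ hj, hwj]
          exact hvj
        · rwa [Finset.piecewise_eq_of_notMem _ _ _ hj]
      · rw [Function.update_self]
        exact hvw k

theorem IsIdealPred.hasNonzeroMul {OA : OperadAlgebraOn F O A} {P Q : Submodule F A}
    (hP : IsIdealPred OA P) (hQ : IsIdealPred OA Q) (hPQ : IsCompl P Q) (hne : P ≠ ⊥)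
    (hpre : preRad OA = ⊥) (hrad : radAlg OA = ⊥) : HasNonzeroMul OA P := by
  obtain ⟨x, hxP, hx0⟩ := Submodule.exists_mem_ne_zero_of_ne_bot hne
  have hx : x ∉ radAlg OA := by rwa [hrad, Submodule.mem_bot]
  rw [mem_radAlg_iff, hpre] at hx
  push Not at hx
  obtain ⟨n, hn, c, v, j, hv⟩ := hx
  rw [OA.op_apply, Submodule.mem_bot] at hv
  have hdecomp : ∀ k, ∃ p ∈ P, v k - p ∈ Q := fun k => by
    obtain ⟨p, hp, q, hq, h⟩ := Submodule.mem_sup.1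
      (hPQ.sup_eq_top ▸ Submodule.mem_top : v k ∈ P ⊔ Q)
    exact ⟨p, hp, by rwa [← h, add_sub_cancel_left]⟩
  choose p hp hpQ using hdecomp
  refine ⟨n, hn, c, Function.update p j x, fun k => ?_, ?_⟩
  · rcases eq_or_ne k j with rfl | hk
    · simpa
    · simpa [hk] using hp k
  · rwa [← hP.α_congr hQ hPQ.disjoint c (w := Function.update v j x) j (by simpa) (by simp)]
    intro k
    rcases eq_or_ne k j with rfl | hk
    · simp
    · simpa [hk] using hpQ k

theorem isSimplePiece_restrictScalars [FiniteDimensional F A] {OA : OperadAlgebraOn F O A}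
    (hpre : preRad OA = ⊥) (hrad : radAlg OA = ⊥) {N : Submodule (multAlg OA) A}
    (hN : IsAtom N) : IsSimplePiece OA (N.restrictScalars F) := by
  have := isSemisimpleModule_multAlg hpre
  obtain ⟨N', hN'⟩ := exists_isCompl N
  refine ⟨isIdealPred_restrictScalars N, fun J hJN hJ => ?_, ?_⟩
  · rcases hN.le_iff.1 (show hJ.toSubmodule ≤ N from hJN) with h | h
    · left
      rw [← hJ.restrictScalars_toSubmodule, h, Submodule.restrictScalars_bot]
    · right
      rw [← hJ.restrictScalars_toSubmodule, h]
  · refine (isIdealPred_restrictScalars N).hasNonzeroMul (isIdealPred_restrictScalars N')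
      ⟨?_, ?_⟩ (fun h => hN.1 ?_) hpre hrad
    · rw [disjoint_iff, ← Submodule.restrictScalars_inf, hN'.inf_eq_bot,
        Submodule.restrictScalars_bot]
    · rw [codisjoint_iff, ← Submodule.restrictScalars_sup, hN'.sup_eq_top,
        Submodule.restrictScalars_top]
    · exact Submodule.restrictScalars_injective F _ _
        (h.trans (Submodule.restrictScalars_bot F (multAlg OA) A).symm)

theorem isSemisimpleAlg_of_radAlg_eq_bot [FiniteDimensional F A] {OA : OperadAlgebraOn F O A}
    (hpre : preRad OA = ⊥) (hrad : radAlg OA = ⊥) : IsSemisimpleAlg OA := by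
  have := isSemisimpleModule_multAlg hpre
  obtain ⟨s, hind, htop, hsimple⟩ :=
    IsSemisimpleModule.exists_sSupIndep_sSup_simples_eq_top (multAlg OA) A
  have := (WellFoundedGT.finite_of_sSupIndep hind).to_subtype
  obtain ⟨m, ⟨e⟩⟩ := Finite.exists_equiv_fin s
  refine ⟨m, fun i => (e.symm i : Submodule (multAlg OA) A).restrictScalars F, fun i => ?_, ?_,
    fun i => isSimplePiece_restrictScalars hpre hrad
      (isSimpleModule_iff_isAtom.1 (hsimple _ (e.symm i).2))⟩
  · have h := ((sSupIndep_iff s).1 hind).comp e.symm.injective i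
    rw [disjoint_iff] at h ⊢
    simp only [Function.comp_apply] at h
    simp only [← Submodule.restrictScalars_iSup, ← Submodule.restrictScalars_inf, h,
      Submodule.restrictScalars_bot]
  · rw [← Submodule.restrictScalars_iSup, e.symm.iSup_comp (g := fun N : s => N.1),
      ← sSup_eq_iSup', htop, Submodule.restrictScalars_top]

/-- a simple `G`-equivariant `C`-algebra has zero radical, i.e., it is a
semisimple `C`-algebra. -/
theorem radical_of_equivariant_simple {F : Type} [Field F] {O : LinearOperadData F}
    {A : Type} [AddCommGroup A] [Module F A] [FiniteDimensional F A]
    (OA : OperadAlgebraOn F O A)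
    (G : Type) [Group G] [Finite G]
    (ρ : G →* (A ≃ₗ[F] A)) (hρ : ∀ g, ρ g ∈ AlgAutGroup OA)
    (hsimple : ∀ I : Submodule F A, IsIdealPred OA I →
      (∀ g, ∀ x ∈ I, ρ g x ∈ I) → I = ⊥ ∨ I = ⊤)
    (hE : EA OA ≠ ⊥) :
    radAlg OA = ⊥ ∧ IsSemisimpleAlg OA := by
  have : Nontrivial A := by
    by_contra h
    rw [not_nontrivial_iff_subsingleton] at h
    exact hE (Subsingleton.elim _ _)
  have hpre : preRad OA = ⊥ :=
    (hsimple _ (isIdealPred_preRad OA) fun g _ hx => map_mem_preRad (hρ g) hx).resolve_right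
      (preRad_ne_top OA)
  have hrad : radAlg OA = ⊥ := by
    refine (hsimple _ (isIdealPred_radAlg OA) fun g _ hx =>
      map_mem_radAlg (hρ g) hx).resolve_right fun h => hE ?_
    rw [EA, Submodule.span_eq_bot]
    rintro _ ⟨n, hn, c, v, j, rfl⟩
    ext a
    have ha := mem_radAlg_iff.1 (h ▸ Submodule.mem_top : a ∈ radAlg OA) n hn c v j
    rwa [hpre, Submodule.mem_bot] at ha
  exact ⟨hrad, isSemisimpleAlg_of_radAlg_eq_bot hpre hrad⟩
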